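/- Let m ≥ 2, λ₁ ∈ ℂ \ {0}, and let g and ρ be holomorphic functions near 0 ∈ ℂ with g(u) = λ₁·u·(1 + O(u)) and ρ(u) = u^{m−1}·(1 + O(u)). Then the time map T(u) := ∫₀^u ρ(s)/g(s) ds is holomorphic near u = 0 and satisfies T(u) = (1/(λ₁(m−1)))·u^{m−1}·(1 + O(u)); in particular T has a zero of exact order m−1 at u = 0. Consequently, for every sufficiently small simple closed loop γ^u around u = 0, the image path T ∘ γ^u is a closed loop in ℂ \ {0} with winding number m−1 around 0: the dynamics u̇(t₁) = g(u) on a trivial stable leaf {z = 0} (with λ₁ < 0), rescaled to original time dt = ρ(u)dt₁, admits a discrepancy-free blow-up loop (γ^t, γ^u) with 𝔴(γ^t, 0) = m−1 for every simple cycle γ^u. -/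

import Mathlib

open Metric

/-- Winding number (as a complex number) of a differentiable closed path
`γ : [0,1] → ℂ` around a point `p`. -/
noncomputable def wnd (γ : ℝ → ℂ) (p : ℂ) : ℂ :=
  (2 * (Real.pi : ℂ) * Complex.I)⁻¹ * ∫ s in (0:ℝ)..1, deriv γ s / (γ s - p)

lemma aux_eq_zero {A B : ℂ → ℂ} {r : ℝ} (hr : 0 < r) (hA : ContinuousAt A 0)
    (hB : ContinuousAt B 0) (h : ∀ u ∈ ball (0:ℂ) r, u ≠ 0 → A u = B u) : A 0 = B 0 := by
  have hA' : Filter.Tendsto A (nhdsWithin 0 {0}ᶜ) (nhds (A 0)) := hA.mono_left nhdsWithin_le_nhds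
  have hB' : Filter.Tendsto B (nhdsWithin 0 {0}ᶜ) (nhds (B 0)) := hB.mono_left nhdsWithin_le_nhds
  refine tendsto_nhds_unique_of_eventuallyEq hA' hB' ?_
  filter_upwards [self_mem_nhdsWithin, nhdsWithin_le_nhds (ball_mem_nhds (0:ℂ) hr)] with u h1 h2
  exact h u h2 h1

lemma aux_factor {F : ℂ → ℂ} {r : ℝ} (hr : 0 < r) (hF : DifferentiableOn ℂ F (ball 0 r)) :
    DifferentiableOn ℂ (dslope F 0) (ball 0 r) ∧
      ∀ u, F u = F 0 + u * dslope F 0 u := by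
  refine ⟨(Complex.differentiableOn_dslope (ball_mem_nhds (0:ℂ) hr)).2 hF, fun u => ?_⟩
  have := sub_smul_dslope F 0 u
  simp only [sub_zero, smul_eq_mul] at this
  rw [this]; ring

lemma aux_pow_deriv {S : ℂ → ℂ} {r : ℝ} (hS : DifferentiableOn ℂ S (ball 0 r)) (j : ℕ)
    {u : ℂ} (hu : u ∈ ball (0:ℂ) r) :
    HasDerivAt (fun v => v ^ (j + 1) * S v) (u ^ j * ((j + 1) * S u + u * deriv S u)) u := by
  have h1 := ((hS.differentiableAt (isOpen_ball.mem_nhds hu)).hasDerivAt)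
  have h2 : HasDerivAt (fun v => v ^ (j + 1) * S v) _ u := (hasDerivAt_pow (j + 1) u).mul h1
  refine h2.congr_deriv ?_
  rw [Nat.add_sub_cancel]
  push_cast
  ring

lemma aux_rel {T S H : ℂ → ℂ} {r : ℝ} (k j : ℕ) (hjk : j ≤ k)
    (hT : ∀ u ∈ ball (0:ℂ) r, HasDerivAt T (u ^ k * H u) u)
    (hS : DifferentiableOn ℂ S (ball 0 r))
    (hTS : ∀ u ∈ ball (0:ℂ) r, T u = u ^ (j + 1) * S u) :
    ∀ u ∈ ball (0:ℂ) r, u ≠ 0 → (j + 1) * S u + u * deriv S u = u ^ (k - j) * H u := by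
  intro u hu hu0
  have h1 := aux_pow_deriv hS j hu
  have h2 : HasDerivAt (fun v => v ^ (j + 1) * S v) (u ^ k * H u) u := by
    refine (hT u hu).congr_of_eventuallyEq ?_
    filter_upwards [isOpen_ball.mem_nhds hu] with v hv
    exact (hTS v hv).symm
  have h3 := h1.unique h2
  obtain ⟨d, rfl⟩ := Nat.exists_eq_add_of_le hjk
  rw [pow_add, mul_assoc] at h3
  rw [Nat.add_sub_cancel_left]
  exact mul_left_cancel₀ (pow_ne_zero j hu0) h3

lemma aux_rel_zero {T S H : ℂ → ℂ} {r : ℝ} (hr : 0 < r) (k j : ℕ) (hjk : j ≤ k)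
    (hH : DifferentiableOn ℂ H (ball 0 r))
    (hT : ∀ u ∈ ball (0:ℂ) r, HasDerivAt T (u ^ k * H u) u)
    (hS : DifferentiableOn ℂ S (ball 0 r))
    (hTS : ∀ u ∈ ball (0:ℂ) r, T u = u ^ (j + 1) * S u) :
    (j + 1) * S 0 = 0 ^ (k - j) * H 0 := by
  have hb := ball_mem_nhds (0:ℂ) hr
  have c1 : ContinuousAt S 0 := (hS.differentiableAt hb).continuousAt
  have c2 : ContinuousAt (deriv S) 0 := ((hS.deriv isOpen_ball).differentiableAt hb).continuousAt
  have c3 : ContinuousAt H 0 := (hH.differentiableAt hb).continuousAt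
  have := aux_eq_zero (A := fun u => (j + 1) * S u + u * deriv S u)
    (B := fun u => u ^ (k - j) * H u) hr (by fun_prop) (by fun_prop)
    (aux_rel k j hjk hT hS hTS)
  simpa using this

lemma aux_order {T H : ℂ → ℂ} {r : ℝ} (hr : 0 < r) (k : ℕ)
    (hH : DifferentiableOn ℂ H (ball 0 r))
    (hT : ∀ u ∈ ball (0:ℂ) r, HasDerivAt T (u ^ k * H u) u) (hT0 : T 0 = 0) (j : ℕ)
    (hjk : j ≤ k) :
    ∃ S : ℂ → ℂ, DifferentiableOn ℂ S (ball 0 r) ∧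
      ∀ u ∈ ball (0:ℂ) r, T u = u ^ (j + 1) * S u := by
  induction j with
  | zero =>
    have hTd : DifferentiableOn ℂ T (ball 0 r) :=
      fun u hu => (hT u hu).differentiableAt.differentiableWithinAt
    obtain ⟨h1, h2⟩ := aux_factor hr hTd
    refine ⟨_, h1, fun u _ => ?_⟩
    rw [h2 u, hT0]; simp
  | succ j ih =>
    obtain ⟨S, hS, hTS⟩ := ih (by omega)
    have h0 := aux_rel_zero hr k j (by omega) hH hT hS hTS
    rw [zero_pow (by omega), zero_mul] at h0
    have hS0 : S 0 = 0 := by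
      rcases mul_eq_zero.1 h0 with h | h
      · exact absurd h (by exact_mod_cast Nat.succ_ne_zero j)
      · exact h
    obtain ⟨h1, h2⟩ := aux_factor hr hS
    refine ⟨_, h1, fun u hu => ?_⟩
    rw [hTS u hu, h2 u, hS0]; ring

lemma aux_ne_zero {F : ℂ → ℂ} {r : ℝ} (hr : 0 < r) (hF : DifferentiableOn ℂ F (ball 0 r))
    (h0 : F 0 ≠ 0) : ∃ r', 0 < r' ∧ r' ≤ r ∧ ∀ u ∈ ball (0:ℂ) r', F u ≠ 0 := by
  have c1 : ContinuousAt F 0 := (hF.differentiableAt (ball_mem_nhds (0:ℂ) hr)).continuousAt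
  obtain ⟨e, he, hb⟩ := Metric.eventually_nhds_iff_ball.1 (c1.eventually_ne h0)
  exact ⟨min e r, lt_min he hr, min_le_right _ _,
    fun u hu => hb u (ball_subset_ball (min_le_left _ _) hu)⟩

lemma aux_wnd {T S : ℂ → ℂ} {r : ℝ} (k : ℕ)
    (hS : DifferentiableOn ℂ S (ball 0 r)) (hS0 : ∀ u ∈ ball (0:ℂ) r, S u ≠ 0)
    (hTS : ∀ u ∈ ball (0:ℂ) r, T u = u ^ (k + 1) * S u)
    (γ dγ : ℝ → ℂ) (hγ : ∀ s ∈ Set.Icc (0:ℝ) 1, HasDerivAt γ (dγ s) s)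
    (hdγ : ContinuousOn dγ (Set.Icc 0 1))
    (hγb : ∀ s ∈ Set.Icc (0:ℝ) 1, γ s ∈ ball (0:ℂ) r ∧ γ s ≠ 0)
    (h01 : γ 0 = γ 1) (hw : wnd γ 0 = 1) :
    wnd (fun s => T (γ s)) 0 = (k : ℂ) + 1 := by
  have hIcc : Set.uIcc (0:ℝ) 1 = Set.Icc 0 1 := Set.uIcc_of_le zero_le_one
  have hγc : ContinuousOn γ (Set.Icc 0 1) := fun s hs => (hγ s hs).continuousAt.continuousWithinAt
  have hmaps : Set.MapsTo γ (Set.Icc 0 1) (ball (0:ℂ) r) := fun s hs => (hγb s hs).1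
  have hL : DifferentiableOn ℂ (fun u => deriv S u / S u) (ball 0 r) :=
    (hS.deriv isOpen_ball).div hS hS0
  obtain ⟨L, hLd⟩ := hL.isExactOn_ball
  have hc1 : ContinuousOn (fun s => dγ s / γ s) (Set.Icc 0 1) :=
    hdγ.div hγc fun s hs => (hγb s hs).2
  have hc2 : ContinuousOn (fun s => deriv S (γ s) / S (γ s) * dγ s) (Set.Icc 0 1) :=
    (hL.continuousOn.comp hγc hmaps).mul hdγ
  have i1 : IntervalIntegrable (fun s => dγ s / γ s) MeasureTheory.volume 0 1 :=
    ContinuousOn.intervalIntegrable (by rwa [hIcc])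
  have i2 : IntervalIntegrable (fun s => deriv S (γ s) / S (γ s) * dγ s)
      MeasureTheory.volume 0 1 :=
    ContinuousOn.intervalIntegrable (by rwa [hIcc])
  have z2 : ∫ s in (0:ℝ)..1, deriv S (γ s) / S (γ s) * dγ s = 0 := by
    rw [intervalIntegral.integral_eq_sub_of_hasDerivAt (f := fun s => L (γ s)) ?_ i2]
    · simp [h01]
    · intro s hs
      rw [hIcc] at hs
      exact (hLd _ (hmaps hs)).comp s (hγ s hs)
  have e1 : ∫ s in (0:ℝ)..1, deriv γ s / (γ s - 0) = ∫ s in (0:ℝ)..1, dγ s / γ s := by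
    refine intervalIntegral.integral_congr fun s hs => ?_
    rw [hIcc] at hs
    simp only [sub_zero, (hγ s hs).deriv]
  have e2 : ∫ s in (0:ℝ)..1, deriv (fun s => T (γ s)) s / (T (γ s) - 0) =
      ∫ s in (0:ℝ)..1, (((k : ℂ) + 1) * (dγ s / γ s) + deriv S (γ s) / S (γ s) * dγ s) := by
    refine intervalIntegral.integral_congr fun s hs => ?_
    rw [hIcc] at hs
    have hTd : HasDerivAt T ((γ s) ^ k * ((k + 1) * S (γ s) + γ s * deriv S (γ s))) (γ s) := by
      refine (aux_pow_deriv hS k (hmaps hs)).congr_of_eventuallyEq ?_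
      filter_upwards [isOpen_ball.mem_nhds (hmaps hs)] with v hv
      exact hTS v hv
    have hd : HasDerivAt (fun s => T (γ s)) _ s := hTd.comp s (hγ s hs)
    have n1 := (hγb s hs).2
    have n2 := hS0 _ (hmaps hs)
    simp only [sub_zero, hd.deriv]
    rw [hTS _ (hmaps hs)]
    field_simp
    ring
  unfold wnd at hw ⊢
  rw [e1] at hw
  rw [e2, intervalIntegral.integral_add (i1.const_mul _) i2, z2, add_zero,
    intervalIntegral.integral_const_mul, mul_left_comm, hw, mul_one]

/-- the time map `T(u) = ∫₀^u ρ/g` on a trivial stable leaf has a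
zero of exact order `m−1` at `u = 0`, with expansion
`T(u) = u^{m−1}/(λ₁(m−1))·(1+O(u))`; hence every small simple loop `γ^u` around
`u = 0` yields a blow-up loop `γ^t = T∘γ^u` with winding number `m−1`. -/
theorem stable_leaf_time_map
    (m : ℕ) (hm : 2 ≤ m) (lam₁ : ℂ) (hlam₁ : lam₁ ≠ 0)
    (g ρ G R : ℂ → ℂ) (r₀ : ℝ) (hr₀ : 0 < r₀)
    (hg : DifferentiableOn ℂ g (ball 0 r₀))
    (hρ : DifferentiableOn ℂ ρ (ball 0 r₀))
    (hG : DifferentiableOn ℂ G (ball 0 r₀))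
    (hR : DifferentiableOn ℂ R (ball 0 r₀))
    (hgexp : ∀ u ∈ ball (0:ℂ) r₀, g u = lam₁ * u * (1 + u * G u))
    (hρexp : ∀ u ∈ ball (0:ℂ) r₀, ρ u = u ^ (m - 1) * (1 + u * R u)) :
    ∃ (r : ℝ) (T E : ℂ → ℂ), 0 < r ∧ r ≤ r₀ ∧
      DifferentiableOn ℂ T (ball 0 r) ∧ T 0 = 0 ∧
      (∀ u ∈ ball (0:ℂ) r, u ≠ 0 → HasDerivAt T (ρ u / g u) u) ∧
      DifferentiableOn ℂ E (ball 0 r) ∧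
      (∀ u ∈ ball (0:ℂ) r,
        T u = (lam₁ * ((m : ℂ) - 1))⁻¹ * u ^ (m - 1) * (1 + u * E u)) ∧
      (∀ γ dγ : ℝ → ℂ,
        (∀ s ∈ Set.Icc (0:ℝ) 1, HasDerivAt γ (dγ s) s) →
        ContinuousOn dγ (Set.Icc 0 1) →
        (∀ s ∈ Set.Icc (0:ℝ) 1, γ s ∈ ball (0:ℂ) r ∧ γ s ≠ 0) →
        γ 0 = γ 1 → wnd γ 0 = 1 →
        (∀ s ∈ Set.Icc (0:ℝ) 1, T (γ s) ≠ 0) ∧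
        wnd (fun s => T (γ s)) 0 = (m : ℂ) - 1) := by
  obtain ⟨k, rfl⟩ : ∃ k, m = k + 2 := ⟨m - 2, by omega⟩
  have hk : k + 2 - 1 = k + 1 := rfl
  have hk1 : ((k + 2 : ℕ) : ℂ) - 1 = (k : ℂ) + 1 := by push_cast; ring
  have hk0 : (k : ℂ) + 1 ≠ 0 := by exact_mod_cast Nat.succ_ne_zero k
  rw [hk1]
  have hden : DifferentiableOn ℂ (fun u => 1 + u * G u) (ball 0 r₀) := by fun_prop
  obtain ⟨r₁, hr₁, hr₁₀, hne⟩ := aux_ne_zero hr₀ hden (by simp)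
  have hsub := ball_subset_ball (x := (0:ℂ)) hr₁₀
  have hH : DifferentiableOn ℂ (fun u => lam₁⁻¹ * ((1 + u * R u) / (1 + u * G u)))
      (ball 0 r₁) := by
    have h1 : DifferentiableOn ℂ (fun u => 1 + u * R u) (ball 0 r₁) := by
      have := hR.mono hsub
      fun_prop
    exact (h1.div (hden.mono hsub) hne).const_mul _
  set H : ℂ → ℂ := fun u => lam₁⁻¹ * ((1 + u * R u) / (1 + u * G u)) with hHdef
  have hH0 : H 0 = lam₁⁻¹ := by simp [hHdef]
  have hkH : DifferentiableOn ℂ (fun u => u ^ k * H u) (ball 0 r₁) := by fun_prop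
  obtain ⟨T, hT0, hT⟩ := hkH.isExactOn_ball.with_val_at 0 0
  obtain ⟨S, hS, hTS⟩ := aux_order hr₁ k hH hT hT0 k le_rfl
  have hS0 := aux_rel_zero hr₁ k k le_rfl hH hT hS hTS
  rw [Nat.sub_self, pow_zero, one_mul, hH0] at hS0
  have hS0' : S 0 = (lam₁ * ((k : ℂ) + 1))⁻¹ := by
    rw [mul_inv, ← hS0]; field_simp
  have hc : (lam₁ * ((k : ℂ) + 1)) ≠ 0 := mul_ne_zero hlam₁ hk0
  obtain ⟨r, hr, hrr₁, hSne⟩ := aux_ne_zero hr₁ hS (by rw [hS0']; exact inv_ne_zero hc)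
  have hsub' := ball_subset_ball (x := (0:ℂ)) hrr₁
  obtain ⟨hE, hSE⟩ := aux_factor hr₁ hS
  refine ⟨r, T, fun u => (lam₁ * ((k : ℂ) + 1)) * dslope S 0 u, hr, hrr₁.trans hr₁₀,
    fun u hu => (hT u (hsub' hu)).differentiableAt.differentiableWithinAt, hT0, ?_,
    (hE.mono hsub').const_mul _, ?_, ?_⟩
  · intro u hu hu0
    have hu1 := hsub' hu
    have hu2 := hsub hu1
    refine (hT u hu1).congr_deriv ?_
    have hn := hne u hu1
    rw [hgexp u hu2, hρexp u hu2, hHdef, hk, pow_succ]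
    field_simp
  · intro u hu
    rw [hTS u (hsub' hu), hSE u, hS0', hk]
    field_simp
  · intro γ dγ hγ hdγ hγb h01 hw
    refine ⟨fun s hs => ?_, aux_wnd k (hS.mono hsub') hSne (fun u hu => hTS u (hsub' hu))
      γ dγ hγ hdγ hγb h01 hw⟩
    rw [hTS _ (hsub' (hγb s hs).1)]
    exact mul_ne_zero (pow_ne_zero _ (hγb s hs).2) (hSne _ (hγb s hs).1)
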